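/- A snake in 𝔅_n is a signed permutation w ∈ 𝔅_n with 0 < w_1 > w_2 < w_3 > w_4 < ⋯, i.e. (with w_0 = 0) w_i < w_{i+1} for every even i ∈ {0,…,n−1} and w_i > w_{i+1} for every odd i ∈ {0,…,n−1}; let S_n^B(q) = Σ_{w snake in 𝔅_n} q^{inv_B(w)} (S_0^B(q) = 1). Then in ℚ(q)[[u]]: (Σ_{n≥0} S_n^B(q)·u^n/B_n(1,q)) · cos_q(u) = cos_q(u)·cos_B(u;q) + (1 + sin_q(u))·sin_B(u;q). -/

import Mathlib

open Finset

/-- The hyperoctahedral group `𝔅_n`, encoded as (permutation of positions, signs):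
the signed permutation sends `i+1` to `±(σ i + 1)`. -/
abbrev BG (n : ℕ) := Equiv.Perm (Fin n) × (Fin n → Bool)

/-- The value `π_i` (for `1 ≤ i ≤ n`) of the signed permutation, with `π_0 = 0`. -/
def bval {n : ℕ} (w : BG n) (i : ℕ) : ℤ :=
  if h : 1 ≤ i ∧ i ≤ n then
    (if w.2 ⟨i - 1, by omega⟩ then -1 else 1) * (((w.1 ⟨i - 1, by omega⟩ : Fin n) : ℕ) + 1 : ℤ)
  else 0

/-- `edes_B`: even `i ∈ {0,…,n−1}` with `π_i > π_{i+1}`. -/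
def edesB {n : ℕ} (w : BG n) : ℕ :=
  ((range n).filter fun i => Even i ∧ bval w (i + 1) < bval w i).card

/-- `odes_B`: odd `i ∈ {0,…,n−1}` with `π_i > π_{i+1}`. -/
def odesB {n : ℕ} (w : BG n) : ℕ :=
  ((range n).filter fun i => Odd i ∧ bval w (i + 1) < bval w i).card

/-- `easc_B`: even `i ∈ {0,…,n−1}` with `π_i < π_{i+1}`. -/
def eascB {n : ℕ} (w : BG n) : ℕ :=
  ((range n).filter fun i => Even i ∧ bval w i < bval w (i + 1)).card

/-- `oasc_B`: odd `i ∈ {0,…,n−1}` with `π_i < π_{i+1}`. -/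
def oascB {n : ℕ} (w : BG n) : ℕ :=
  ((range n).filter fun i => Odd i ∧ bval w i < bval w (i + 1)).card

/-- type B inversion number -/
def invB {n : ℕ} (w : BG n) : ℕ :=
  ((Icc 1 n ×ˢ Icc 1 n).filter fun p => p.1 < p.2 ∧ bval w p.2 < bval w p.1).card
  + ((Icc 1 n ×ˢ Icc 1 n).filter fun p => p.1 < p.2 ∧ bval w p.2 < -bval w p.1).card
  + ((Icc 1 n).filter fun i => bval w i < 0).card

/-- `B_n(s,t,q)` -/
noncomputable def Bpoly {A : Type*} [CommRing A] (n : ℕ) (s t q : A) : A :=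
  ∑ w : BG n, s ^ edesB w * t ^ odesB w * q ^ invB w

/-- `B_n(1,q)` -/
noncomputable def BOne {A : Type*} [CommRing A] (n : ℕ) (q : A) : A :=
  ∑ w : BG n, q ^ invB w

/-- `[k]_q` -/
def qInt {A : Type*} [CommRing A] (k : ℕ) (q : A) : A := ∑ i ∈ range k, q ^ i

/-- `[k]_q!` -/
def qFact {A : Type*} [CommRing A] (k : ℕ) (q : A) : A := ∏ i ∈ range k, qInt (i + 1) q

noncomputable section

/-- the field `ℚ(q)` -/
abbrev Kq : Type := RatFunc ℚ

/-- the variable `q` -/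
def qv : Kq := RatFunc.X

/-- the set of snakes `0 < w_1 > w_2 < w_3 > ⋯` in `𝔅_n` (with `w_0 = 0`) -/
def SnakeB (n : ℕ) : Finset (BG n) :=
  univ.filter fun w => ∀ i : ℕ, i < n →
    (Even i → bval w i < bval w (i + 1)) ∧ (Odd i → bval w (i + 1) < bval w i)

/-- `S_n^B(q)` -/
def SB (n : ℕ) : Kq := ∑ w ∈ SnakeB n, qv ^ invB w

open PowerSeries

/-- `cos_q(u)` -/
def cosq : PowerSeries Kq := PowerSeries.mk fun j =>
  if Even j then (-1 : Kq) ^ (j / 2) * (qFact j qv)⁻¹ else 0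

/-- `sin_q(u)` -/
def sinq : PowerSeries Kq := PowerSeries.mk fun j =>
  if Odd j then (-1 : Kq) ^ (j / 2) * (qFact j qv)⁻¹ else 0

/-- `cos_B(u;q)` -/
def cosB : PowerSeries Kq := PowerSeries.mk fun j =>
  if Even j then (-1 : Kq) ^ (j / 2) * (BOne j qv)⁻¹ else 0

/-- `sin_B(u;q)` -/
def sinB : PowerSeries Kq := PowerSeries.mk fun j =>
  if Odd j then (-1 : Kq) ^ (j / 2) * (BOne j qv)⁻¹ else 0

/-- The type B inversion number of the word `f 1, …, f n`. -/
def wordInv (f : ℕ → ℤ) (n : ℕ) : ℕ :=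
  ∑ j ∈ range n, (∑ i ∈ range j, ((if f (j + 1) < f (i + 1) then 1 else 0)
    + (if f (j + 1) < -f (i + 1) then 1 else 0)) + if f (j + 1) < 0 then 1 else 0)

theorem wordInv_succ (f : ℕ → ℤ) (n : ℕ) : wordInv f (n + 1) = wordInv f n +
    (∑ i ∈ range n, ((if f (n + 1) < f (i + 1) then 1 else 0)
    + (if f (n + 1) < -f (i + 1) then 1 else 0)) + if f (n + 1) < 0 then 1 else 0) :=
  sum_range_succ _ _

theorem sum_Icc_one (n : ℕ) (g : ℕ → ℕ) : ∑ i ∈ Icc 1 n, g i = ∑ i ∈ range n, g (i + 1) := by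
  induction n with
  | zero => simp
  | succ n ih => rw [sum_Icc_succ_top (by omega), ih, sum_range_succ]

theorem card_filter_pairs (n : ℕ) (P : ℕ → ℕ → Prop) [∀ i j, Decidable (P i j)] :
    ((Icc 1 n ×ˢ Icc 1 n).filter fun p => p.1 < p.2 ∧ P p.1 p.2).card
      = ∑ j ∈ range n, ∑ i ∈ range j, if P (i + 1) (j + 1) then 1 else 0 := by
  rw [card_filter, sum_product_right, sum_Icc_one]
  refine sum_congr rfl fun j hj => ?_
  rw [sum_Icc_one]
  simp only [mem_range] at hj
  have h : range j = (range n).filter fun i => i + 1 < j + 1 := by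
    ext i
    simp only [mem_range, mem_filter]
    omega
  rw [h, sum_filter]
  refine sum_congr rfl fun i _ => ?_
  by_cases h1 : i + 1 < j + 1 <;> simp [h1]

theorem invB_eq_wordInv {n : ℕ} (w : BG n) : invB w = wordInv (bval w) n := by
  unfold invB wordInv
  rw [card_filter_pairs n fun i j => bval w j < bval w i,
    card_filter_pairs n fun i j => bval w j < -bval w i, card_filter, sum_Icc_one]
  simp only [sum_add_distrib]

theorem bval_zero {n : ℕ} (w : BG n) : bval w 0 = 0 := by simp [bval]

theorem bval_succ {n : ℕ} (w : BG n) (i : Fin n) :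
    bval w (i + 1) = (if w.2 i then -1 else 1) * ((w.1 i : ℕ) + 1 : ℤ) := by
  have : 1 ≤ (i : ℕ) + 1 ∧ (i : ℕ) + 1 ≤ n := by omega
  simp [bval, this]

theorem abs_bval_succ {n : ℕ} (w : BG n) (i : Fin n) :
    |bval w (i + 1)| = ((w.1 i : ℕ) + 1 : ℤ) := by
  have h : (0 : ℤ) ≤ (w.1 i : ℕ) + 1 := by positivity
  rw [bval_succ, abs_mul, abs_of_nonneg h]
  split_ifs <;> simp

theorem bval_injOn {n : ℕ} (w : BG n) {i j : ℕ} (hi : i < n) (hj : j < n)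
    (h : bval w (i + 1) = bval w (j + 1)) : i = j := by
  have h1 := abs_bval_succ w ⟨i, hi⟩
  have h2 := abs_bval_succ w ⟨j, hj⟩
  simp only at h1 h2
  rw [h, h2] at h1
  have : w.1 ⟨i, hi⟩ = w.1 ⟨j, hj⟩ := Fin.ext (by omega)
  simpa using w.1.injective this

theorem sum_range_comp_swap {M : Type*} [AddCommMonoid M] (G : ℕ → M) (b t : ℕ) :
    ∑ i ∈ range (b + 2 + t), G (Equiv.swap (b + 1) (b + 2) (i + 1))
      = ∑ i ∈ range (b + 2 + t), G (i + 1) := by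
  induction t with
  | zero =>
    simp only [add_zero, sum_range_succ, Equiv.swap_apply_left, Equiv.swap_apply_right]
    rw [add_assoc, add_assoc, add_comm (G _)]
    congr 1
    refine sum_congr rfl fun i hi => ?_
    simp only [mem_range] at hi
    rw [Equiv.swap_apply_of_ne_of_ne (by omega) (by omega)]
  | succ t ih =>
    rw [← add_assoc, sum_range_succ, ih, sum_range_succ,
      Equiv.swap_apply_of_ne_of_ne (by omega) (by omega)]

theorem wordInv_comp_swap (f : ℕ → ℤ) (b t : ℕ) (h : f (b + 1) < f (b + 2)) :
    wordInv (f ∘ Equiv.swap (b + 1) (b + 2)) (b + 2 + t) = wordInv f (b + 2 + t) + 1 := by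
  induction t with
  | zero =>
    have hs : ∀ i < b, Equiv.swap (b + 1) (b + 2) (i + 1) = i + 1 := fun i hi =>
      Equiv.swap_apply_of_ne_of_ne (by omega) (by omega)
    have h0 : wordInv (f ∘ Equiv.swap (b + 1) (b + 2)) b = wordInv f b := by
      refine sum_congr rfl fun j hj => ?_
      simp only [mem_range] at hj
      simp only [Function.comp, hs j hj]
      congr 1
      refine sum_congr rfl fun i hi => ?_
      simp only [mem_range] at hi
      rw [hs i (by omega)]
    have h1 : ∀ y : ℤ, ∑ i ∈ range b,
        ((if y < f (Equiv.swap (b + 1) (b + 2) (i + 1)) then 1 else 0)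
          + (if y < -f (Equiv.swap (b + 1) (b + 2) (i + 1)) then 1 else 0))
        = ∑ i ∈ range b, ((if y < f (i + 1) then 1 else 0)
          + (if y < -f (i + 1) then 1 else 0)) := fun y => by
      refine sum_congr rfl fun i hi => ?_
      rw [hs i (by simpa using hi)]
    simp only [add_zero, wordInv_succ, h0, sum_range_succ, Function.comp, h1, add_assoc,
      Nat.reduceAdd, Equiv.swap_apply_left, Equiv.swap_apply_right]
    have e1 : (f (b + 1) < -f (b + 2)) ↔ (f (b + 2) < -f (b + 1)) := by omega
    rw [if_pos h, if_neg h.not_gt]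
    simp only [e1]
    ring
  | succ t ih =>
    rw [← add_assoc, wordInv_succ, ih, wordInv_succ]
    have hs : Equiv.swap (b + 1) (b + 2) (b + 2 + t + 1) = b + 2 + t + 1 :=
      Equiv.swap_apply_of_ne_of_ne (by omega) (by omega)
    simp only [Function.comp, hs]
    rw [sum_range_comp_swap fun i => (if f (b + 2 + t + 1) < f i then 1 else 0)
      + (if f (b + 2 + t + 1) < -f i then 1 else 0)]
    ring

/-- Exchanging the entries at the positions `b + 1` and `b + 2`. -/
def swapBG {n : ℕ} (b : ℕ) (hb : b + 2 ≤ n) : BG n ≃ BG n :=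
  (Equiv.mulRight (Equiv.swap (⟨b, by omega⟩ : Fin n) ⟨b + 1, by omega⟩)).prodCongr
    ((Equiv.swap (⟨b, by omega⟩ : Fin n) ⟨b + 1, by omega⟩).arrowCongr (Equiv.refl Bool))

theorem bval_swapBG {n : ℕ} (b : ℕ) (hb : b + 2 ≤ n) (w : BG n) :
    bval (swapBG b hb w) = bval w ∘ Equiv.swap (b + 1) (b + 2) := by
  have key : ∀ i : Fin n, bval (swapBG b hb w) (i + 1)
      = bval w ((Equiv.swap (⟨b, by omega⟩ : Fin n) ⟨b + 1, by omega⟩ i : Fin n) + 1) := by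
    intro i
    rw [bval_succ, bval_succ]
    simp [swapBG]
  funext i
  simp only [Function.comp]
  rcases eq_or_ne i (b + 1) with rfl | h1
  · simpa using key ⟨b, by omega⟩
  rcases eq_or_ne i (b + 2) with rfl | h2
  · simpa using key ⟨b + 1, by omega⟩
  rw [Equiv.swap_apply_of_ne_of_ne h1 h2]
  by_cases hi : 1 ≤ i ∧ i ≤ n
  · obtain ⟨j, rfl⟩ : ∃ j, i = j + 1 := ⟨i - 1, by omega⟩
    have := key ⟨j, by omega⟩
    rwa [Equiv.swap_apply_of_ne_of_ne (by simp; omega) (by simp; omega)] at this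
  · simp [bval, hi]

/-- Inserting a last entry of absolute value `p + 1` and sign `s`. -/
def snocBG {n : ℕ} (x : BG n × Fin (n + 1) × Bool) : BG (n + 1) :=
  (((finSuccEquiv' (Fin.last n)).trans (Equiv.optionCongr x.1.1)).trans
    (finSuccEquiv' x.2.1).symm, Fin.snoc (α := fun _ => Bool) x.1.2 x.2.2)

theorem snocBG_fst_castSucc {n : ℕ} (x : BG n × Fin (n + 1) × Bool) (i : Fin n) :
    (snocBG x).1 i.castSucc = x.2.1.succAbove (x.1.1 i) := by
  simp [snocBG, finSuccEquiv'_last_apply_castSucc]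

theorem snocBG_fst_last {n : ℕ} (x : BG n × Fin (n + 1) × Bool) :
    (snocBG x).1 (Fin.last n) = x.2.1 := by
  simp [snocBG]

theorem snocBG_bijective (n : ℕ) : Function.Bijective (snocBG (n := n)) := by
  rw [Fintype.bijective_iff_injective_and_card]
  constructor
  · rintro ⟨⟨σ, ε⟩, p, s⟩ ⟨⟨τ, δ⟩, r, t⟩ h
    have hp : p = r := by
      have := congrArg (fun w : BG (n + 1) => w.1 (Fin.last n)) h
      simpa only [snocBG_fst_last] using this
    subst hp
    have h2 : Fin.snoc (α := fun _ => Bool) ε s = Fin.snoc (α := fun _ => Bool) δ t :=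
      congrArg Prod.snd h
    obtain ⟨rfl, rfl⟩ := Fin.snoc_inj.1 h2
    have : σ = τ := by
      ext i
      have := congrArg (fun w : BG (n + 1) => w.1 i.castSucc) h
      simp only [snocBG_fst_castSucc] at this
      rw [Fin.succAbove_right_injective this]
    rw [this]
  · simp [Fintype.card_perm, Nat.factorial_succ]
    ring

/-- The increasing odd map `ℤ → ℤ` whose image omits `±(p + 1)`. -/
def avoid (p : ℕ) (x : ℤ) : ℤ := if x > p then x + 1 else if x < -p then x - 1 else x

theorem avoid_lt_iff (p : ℕ) (x y : ℤ) : avoid p x < avoid p y ↔ x < y := by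
  unfold avoid
  split_ifs <;> omega

theorem avoid_neg (p : ℕ) (x : ℤ) : avoid p (-x) = -avoid p x := by
  unfold avoid
  split_ifs <;> omega

theorem avoid_zero (p : ℕ) : avoid p 0 = 0 := by
  unfold avoid
  split_ifs <;> omega

theorem bval_snocBG {n : ℕ} (x : BG n × Fin (n + 1) × Bool) {i : ℕ} (hi : i ≤ n) :
    bval (snocBG x) i = avoid x.2.1 (bval x.1 i) := by
  rcases i with _ | i
  · simp [bval_zero, avoid_zero]
  have h1 := bval_succ (snocBG x) (Fin.castSucc ⟨i, hi⟩)
  have h2 := bval_succ x.1 ⟨i, hi⟩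
  rw [snocBG_fst_castSucc] at h1
  simp only [Fin.val_castSucc] at h1 h2
  have h3 : (snocBG x).2 (Fin.castSucc ⟨i, hi⟩) = x.1.2 ⟨i, hi⟩ := by
    simp only [snocBG, Fin.snoc_castSucc]
  rw [h1, h2, h3]
  simp only [Fin.succAbove, Fin.lt_def, Fin.val_castSucc, avoid]
  split_ifs <;> simp <;> omega

theorem bval_snocBG_last {n : ℕ} (x : BG n × Fin (n + 1) × Bool) :
    bval (snocBG x) (n + 1) = (if x.2.2 then -1 else 1) * ((x.2.1 : ℕ) + 1 : ℤ) := by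
  have h := bval_succ (snocBG x) (Fin.last n)
  rw [snocBG_fst_last] at h
  simpa [snocBG] using h

theorem wordInv_congr {f g : ℕ → ℤ} {n : ℕ}
    (h : ∀ i j, i ≤ n → j ≤ n → (f i < f j ↔ g i < g j))
    (hneg : ∀ i j, i ≤ n → j ≤ n → (f i < -f j ↔ g i < -g j))
    (hf : f 0 = 0) (hg : g 0 = 0) : wordInv f n = wordInv g n := by
  refine sum_congr rfl fun j hj => ?_
  simp only [mem_range] at hj
  have h0 := h (j + 1) 0 hj (by omega)
  rw [hf, hg] at h0
  simp only [h0]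
  congr 1
  refine sum_congr rfl fun i hi => ?_
  simp only [mem_range] at hi
  simp only [h (j + 1) (i + 1) hj (by omega), hneg (j + 1) (i + 1) hj (by omega)]

/-- The number of inversions created by a last entry of absolute value `p + 1` and sign `s`. -/
theorem wordInv_snocBG {n : ℕ} (x : BG n × Fin (n + 1) × Bool) :
    wordInv (bval (snocBG x)) (n + 1) = wordInv (bval x.1) n +
      if x.2.2 then n + 1 + (x.2.1 : ℕ) else n - (x.2.1 : ℕ) := by
  rw [wordInv_succ, wordInv_congr (g := bval x.1) _ _ (bval_zero _) (bval_zero _)]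
  · congr 1
    have hsum : ∀ G : ℤ → ℕ,
        ∑ i : Fin n, G |bval (snocBG x) (i + 1)| + G ((x.2.1 : ℕ) + 1)
          = ∑ j : Fin (n + 1), G ((j : ℕ) + 1) := by
      intro G
      rw [← Equiv.sum_comp (snocBG x).1, Fin.sum_univ_castSucc, snocBG_fst_last]
      congr 1
      refine sum_congr rfl fun i _ => ?_
      rw [← abs_bval_succ]
      rfl
    have hpos : ∀ i : Fin n, 0 < |bval (snocBG x) (i + 1)| := fun i => by
      have := abs_bval_succ (snocBG x) i.castSucc
      simp only [Fin.val_castSucc] at this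
      rw [this]
      positivity
    have hne : ∀ i : Fin n, |bval (snocBG x) (i + 1)| ≠ (x.2.1 : ℕ) + 1 := fun i => by
      have := abs_bval_succ (snocBG x) i.castSucc
      simp only [Fin.val_castSucc] at this
      rw [this, snocBG_fst_castSucc]
      have := Fin.succAbove_ne x.2.1 (x.1.1 i)
      rw [Ne, Fin.ext_iff] at this
      omega
    rw [sum_range, bval_snocBG_last]
    generalize bval (snocBG x) = f at hsum hpos hne ⊢
    generalize x.2.1 = p at hsum hne ⊢
    generalize x.2.2 = s
    cases s
    · have e := hsum fun z => if (p : ℕ) + 1 < z then 1 else 0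
      have e1 : ∑ j : Fin (n + 1), (if ((p : ℕ) : ℤ) + 1 < (j : ℕ) + 1 then 1 else 0)
          = n - (p : ℕ) := by
        simp [filter_lt_eq_Ioi]
      rw [e1] at e
      have hp : ¬ ((p : ℕ) : ℤ) + 1 < 0 := by omega
      simp only [Bool.false_eq_true, if_false, one_mul, add_zero, lt_irrefl, hp] at e ⊢
      rw [← e]
      refine sum_congr rfl fun i _ => ?_
      have := hpos i
      rcases abs_cases (f (i + 1)) with h | h <;> split_ifs <;> omega
    · have e := hsum fun z => if z < (p : ℕ) + 1 then 1 else 0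
      have e1 : ∑ j : Fin (n + 1), (if (((j : ℕ) : ℤ) + 1 : ℤ) < (p : ℕ) + 1 then 1 else 0)
          = (p : ℕ) := by
        simp [filter_gt_eq_Iio]
      rw [e1] at e
      have hp : -1 * (((p : ℕ) : ℤ) + 1) < 0 := by omega
      simp only [if_true, add_zero, lt_irrefl, if_false, hp] at e ⊢
      have e2 : ∑ i : Fin n, (1 + if |f (i + 1)| < (p : ℕ) + 1 then 1 else 0) = n + p := by
        rw [sum_add_distrib, e]
        simp
      have : n + 1 + (p : ℕ) = n + p + 1 := by ring
      rw [this, ← e2]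
      congr 1
      refine sum_congr rfl fun i _ => ?_
      have := hpos i
      have := hne i
      rcases abs_cases (f (i + 1)) with h | h <;> split_ifs <;> omega
  · intro i j hi hj
    rw [bval_snocBG _ hi, bval_snocBG _ hj, avoid_lt_iff]
  · intro i j hi hj
    rw [bval_snocBG _ hi, bval_snocBG _ hj, ← avoid_neg, avoid_lt_iff]


open Classical in
/-- The `inv_B`-generating function of the signed permutations whose one-line notation
satisfies `P`. -/
def invSum (n : ℕ) (P : (ℕ → ℤ) → Prop) : Kq :=
  ∑ w : BG n, if P (bval w) then qv ^ wordInv (bval w) n else 0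

theorem invSum_congr {n : ℕ} {P Q : (ℕ → ℤ) → Prop}
    (h : ∀ w : BG n, P (bval w) ↔ Q (bval w)) : invSum n P = invSum n Q := by
  classical
  exact sum_congr rfl fun w _ => if_congr (h w) rfl rfl

theorem invSum_eq_add_of_lt {n b : ℕ} (hb : b + 2 ≤ n) (P : (ℕ → ℤ) → Prop) :
    invSum n P = invSum n (fun f => P f ∧ f (b + 1) < f (b + 2))
      + invSum n (fun f => P f ∧ f (b + 2) < f (b + 1)) := by
  unfold invSum
  rw [← sum_add_distrib]
  refine sum_congr rfl fun w _ => ?_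
  have hne : bval w (b + 1) ≠ bval w (b + 2) := fun h => by
    have := bval_injOn w (i := b) (j := b + 1) (by omega) (by omega) h
    omega
  classical
  by_cases hP : P (bval w) <;> rcases lt_or_gt_of_ne hne with h | h <;> simp [hP, h, h.not_gt]

theorem invSum_swap {n b : ℕ} (hb : b + 2 ≤ n) (P Q : (ℕ → ℤ) → Prop)
    (hPQ : ∀ f, P (f ∘ Equiv.swap (b + 1) (b + 2)) ↔ Q f)
    (hQ : ∀ f, Q f → f (b + 1) < f (b + 2)) :
    invSum n P = qv * invSum n Q := by
  unfold invSum
  rw [← Equiv.sum_comp (swapBG b hb), mul_sum]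
  refine sum_congr rfl fun w _ => ?_
  rw [bval_swapBG, hPQ]
  split_ifs with h
  · obtain ⟨t, rfl⟩ := Nat.exists_eq_add_of_le hb
    rw [wordInv_comp_swap _ _ _ (hQ _ h), pow_succ']
  · simp

/-- `P` depends only on the relative order of the entries at the positions `0, …, n`. -/
def IsPattern (n : ℕ) (P : (ℕ → ℤ) → Prop) : Prop :=
  ∀ f g : ℕ → ℤ, (∀ i j, i ≤ n → j ≤ n → (f i < f j ↔ g i < g j)) → (P f ↔ P g)

theorem IsPattern.mono {m n : ℕ} {P : (ℕ → ℤ) → Prop} (h : IsPattern m P) (hmn : m ≤ n) :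
    IsPattern n P :=
  fun f g H => h f g fun i j hi hj => H i j (hi.trans hmn) (hj.trans hmn)

theorem invSum_succ {n : ℕ} {P : (ℕ → ℤ) → Prop} (hP : IsPattern n P) :
    invSum (n + 1) P = qInt (2 * (n + 1)) qv * invSum n P := by
  unfold invSum
  rw [← (snocBG_bijective n).sum_comp, Fintype.sum_prod_type, mul_sum]
  refine sum_congr rfl fun u _ => ?_
  have hp : ∀ x : Fin (n + 1) × Bool, P (bval (snocBG (u, x))) ↔ P (bval u) := fun x =>
    hP _ _ fun i j hi hj => by
      rw [bval_snocBG _ hi, bval_snocBG _ hj, avoid_lt_iff]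
  classical
  refine (sum_congr rfl fun x _ => if_congr (hp x) rfl rfl).trans ?_
  split_ifs
  swap
  · simp
  simp only [wordInv_snocBG, pow_add, ← mul_sum]
  rw [mul_comm]
  congr 1
  rw [Fintype.sum_prod_type, qInt, two_mul, sum_range_add]
  simp only [Fintype.sum_bool, if_true, Bool.false_eq_true, if_false, sum_add_distrib]
  rw [add_comm, sum_range, sum_range]
  congr 1
  · rw [← Equiv.sum_comp Fin.revPerm]
    refine sum_congr rfl fun i _ => ?_
    simp only [Fin.revPerm_apply, Fin.val_rev]
    congr 1
    omega

theorem BOne_eq_invSum (n : ℕ) : BOne n qv = invSum n fun _ => True := by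
  simp [BOne, invSum, invB_eq_wordInv]

theorem BOne_succ (n : ℕ) : BOne (n + 1) qv = qInt (2 * (n + 1)) qv * BOne n qv := by
  rw [BOne_eq_invSum, BOne_eq_invSum, invSum_succ fun _ _ _ => Iff.rfl]

theorem BOne_zero : BOne 0 qv = 1 := by
  simp [BOne_eq_invSum, invSum, wordInv]

/-- `f` increases along the positions `k + 1, …, k + m`. -/
def IncFrom (k m : ℕ) (f : ℕ → ℤ) : Prop := ∀ i, k < i → i < k + m → f i < f (i + 1)

/-- `f` increases along `k + 1, …, n` after removal of position `r`, and `f r < f (r + 1)`. -/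
def IncExcept (k n r : ℕ) (f : ℕ → ℤ) : Prop :=
  (∀ i, k < i → i + 1 < r → f i < f (i + 1)) ∧ (∀ i, r < i → i < n → f i < f (i + 1)) ∧
    (k + 1 < r → r < n → f (r - 1) < f (r + 1)) ∧ (r < n → f r < f (r + 1))

theorem incExcept_first (k m : ℕ) (f : ℕ → ℤ) :
    IncExcept k (k + m + 1) (k + 1) f ↔ IncFrom k (m + 1) f := by
  constructor
  · rintro ⟨-, h2, -, h4⟩ i hi1 hi2
    rcases eq_or_ne i (k + 1) with rfl | hne
    · exact h4 (by omega)
    · exact h2 i (by omega) (by omega)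
  · intro h
    refine ⟨fun i _ _ => ?_, fun i _ _ => h i (by omega) (by omega), fun _ _ => ?_,
      fun _ => h _ (by omega) (by omega)⟩ <;> omega

theorem incExcept_last (k m : ℕ) (f : ℕ → ℤ) :
    IncExcept k (k + m + 1) (k + m + 1) f ↔ IncFrom k m f := by
  constructor
  · rintro ⟨h1, -, -, -⟩ i hi1 hi2
    exact h1 i hi1 (by omega)
  · intro h
    refine ⟨fun i _ _ => h i (by omega) (by omega), fun i _ _ => ?_, fun _ _ => ?_,
      fun _ => ?_⟩ <;> omega

theorem incExcept_succ_and_lt {k n r : ℕ} (hk : k < r) (hr : r < n) (f : ℕ → ℤ) :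
    IncExcept k n (r + 1) f ∧ f r < f (r + 1) ↔ IncFrom k (n - k) f := by
  constructor
  · rintro ⟨⟨h1, h2, -, h4⟩, h5⟩ i hi1 hi2
    rcases lt_trichotomy i r with h | rfl | h
    · exact h1 i hi1 (by omega)
    · exact h5
    · rcases eq_or_ne i (r + 1) with rfl | hne
      · exact h4 (by omega)
      · exact h2 i (by omega) (by omega)
  · intro h
    refine ⟨⟨fun i _ _ => h i (by omega) (by omega), fun i _ _ => h i (by omega) (by omega),
      fun _ _ => ?_, fun _ => h _ (by omega) (by omega)⟩, h _ (by omega) (by omega)⟩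
    exact (h r (by omega) (by omega)).trans (h (r + 1) (by omega) (by omega))

theorem incExcept_swap {k n r : ℕ} (hk : k < r) (hr : r < n) (f : ℕ → ℤ) :
    IncExcept k n (r + 1) (f ∘ Equiv.swap r (r + 1)) ∧
        (f ∘ Equiv.swap r (r + 1)) (r + 1) < (f ∘ Equiv.swap r (r + 1)) r ↔
      IncExcept k n r f := by
  have e1 : (f ∘ Equiv.swap r (r + 1)) r = f (r + 1) := by simp
  have e2 : (f ∘ Equiv.swap r (r + 1)) (r + 1) = f r := by simp
  have e3 : ∀ i, i ≠ r → i ≠ r + 1 → (f ∘ Equiv.swap r (r + 1)) i = f i := fun i h1 h2 => by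
    simp [Equiv.swap_apply_of_ne_of_ne h1 h2]
  generalize f ∘ Equiv.swap r (r + 1) = g at e1 e2 e3
  constructor
  · rintro ⟨⟨h1, h2, h3, h4⟩, h5⟩
    rw [e1, e2] at h5
    refine ⟨fun i hi1 hi2 => ?_, fun i hi1 hi2 => ?_, fun hi1 hi2 => ?_, fun _ => h5⟩
    · have := h1 i hi1 (by omega)
      rwa [e3 i (by omega) (by omega), e3 (i + 1) (by omega) (by omega)] at this
    · rcases eq_or_ne i (r + 1) with rfl | hne
      · have := h3 (by omega) (by omega)
        rwa [Nat.add_sub_cancel, e1, e3 (r + 1 + 1) (by omega) (by omega)] at this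
      · have := h2 i (by omega) hi2
        rwa [e3 i (by omega) (by omega), e3 (i + 1) (by omega) (by omega)] at this
    · have := h1 (r - 1) (by omega) (by omega)
      rwa [Nat.sub_add_cancel (by omega), e3 (r - 1) (by omega) (by omega), e1] at this
  · rintro ⟨h1, h2, h3, h4⟩
    rw [e1, e2]
    refine ⟨⟨fun i hi1 hi2 => ?_, fun i hi1 hi2 => ?_, fun hi1 hi2 => ?_, fun hi => ?_⟩, h4 hr⟩
    · rcases eq_or_ne (i + 1) r with rfl | hne
      · rw [e3 i (by omega) (by omega), e1]
        exact h3 (by omega) (by omega)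
      · rw [e3 i (by omega) (by omega), e3 (i + 1) (by omega) (by omega)]
        exact h1 i hi1 (by omega)
    · rw [e3 i (by omega) (by omega), e3 (i + 1) (by omega) (by omega)]
      exact h2 i (by omega) hi2
    · rw [Nat.add_sub_cancel, e1, e3 (r + 1 + 1) (by omega) (by omega)]
      exact h2 (r + 1) (by omega) (by omega)
    · rw [e2, e3 (r + 1 + 1) (by omega) (by omega)]
      exact (h4 hr).trans (h2 (r + 1) (by omega) (by omega))

theorem qInt_succ' (k : ℕ) : qInt (k + 1) qv = 1 + qv * qInt k qv := by
  rw [qInt, qInt, sum_range_succ', mul_sum, add_comm, pow_zero]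
  simp only [pow_succ']

theorem invSum_incExcept {k m : ℕ} {P : (ℕ → ℤ) → Prop} (hP : IsPattern k P) (s : ℕ)
    (hs : s ≤ m) : invSum (k + m + 1) (fun f => P f ∧ IncExcept k (k + m + 1) (k + s + 1) f)
      = qInt (s + 1) qv * invSum (k + m + 1) fun f => P f ∧ IncFrom k (m + 1) f := by
  induction s with
  | zero =>
    simp only [add_zero, incExcept_first]
    simp [qInt]
  | succ s ih =>
    rw [invSum_eq_add_of_lt (b := k + s) (by omega), qInt_succ', add_mul, one_mul, mul_assoc,
      ← ih (by omega)]
    congr 1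
    · refine invSum_congr fun w => ?_
      rw [and_assoc, ← add_assoc k s 1, incExcept_succ_and_lt (by omega) (by omega)]
      rw [show k + m + 1 - k = m + 1 by omega]
    · refine invSum_swap (b := k + s) (by omega) _ _ (fun f => ?_)
        fun f h => h.2.2.2.2 (by omega)
      rw [and_assoc, ← add_assoc k s 1, incExcept_swap (by omega) (by omega)]
      refine and_congr_left fun _ => hP _ _ fun i j hi hj => ?_
      simp only [Function.comp]
      rw [Equiv.swap_apply_of_ne_of_ne (by omega) (by omega),
        Equiv.swap_apply_of_ne_of_ne (by omega) (by omega)]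

theorem isPattern_and_incFrom {k : ℕ} (m : ℕ) {P : (ℕ → ℤ) → Prop} (hP : IsPattern k P) :
    IsPattern (k + m) fun f => P f ∧ IncFrom k m f := by
  intro f g h
  refine and_congr (hP.mono (by omega) f g h) ?_
  unfold IncFrom
  refine forall_congr' fun i => forall_congr' fun _ => forall_congr' fun _ => ?_
  exact h _ _ (by omega) (by omega)

theorem qInt_mul_invSum_incFrom {k m : ℕ} {P : (ℕ → ℤ) → Prop} (hP : IsPattern k P) :
    qInt (m + 1) qv * invSum (k + m + 1) (fun f => P f ∧ IncFrom k (m + 1) f)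
      = qInt (2 * (k + m + 1)) qv * invSum (k + m) fun f => P f ∧ IncFrom k m f := by
  rw [← invSum_incExcept hP m le_rfl, ← invSum_succ (isPattern_and_incFrom m hP)]
  simp only [incExcept_last]

theorem invSum_incFrom_mul {k : ℕ} {P : (ℕ → ℤ) → Prop} (hP : IsPattern k P) (m : ℕ) :
    invSum (k + m) (fun f => P f ∧ IncFrom k m f) * (qFact m qv * BOne k qv)
      = invSum k P * BOne (k + m) qv := by
  induction m with
  | zero =>
    have : ∀ f, IncFrom k 0 f := fun f i _ _ => by omega
    simp [this, qFact]
  | succ m ih =>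
    have h := qInt_mul_invSum_incFrom (m := m) hP
    have hf : qFact (m + 1) qv = qFact m qv * qInt (m + 1) qv := prod_range_succ _ _
    rw [← add_assoc, BOne_succ, hf]
    linear_combination (qFact m qv * BOne k qv) * h + qInt (2 * (k + m + 1)) qv * ih

theorem qInt_succ_ne_zero (k : ℕ) : qInt (k + 1) qv ≠ 0 := by
  have h : qInt (k + 1) qv
      = algebraMap (Polynomial ℚ) Kq (∑ i ∈ range (k + 1), Polynomial.X ^ i) := by
    simp [qInt, qv]
  rw [h, Ne, map_eq_zero_iff _ (RatFunc.algebraMap_injective ℚ)]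
  intro h0
  have := congrArg (Polynomial.eval 1) h0
  simp [Polynomial.eval_finsetSum] at this
  norm_cast at this

theorem qFact_ne_zero (k : ℕ) : qFact k qv ≠ 0 :=
  prod_ne_zero_iff.2 fun i _ => qInt_succ_ne_zero i

theorem BOne_ne_zero (n : ℕ) : BOne n qv ≠ 0 := by
  induction n with
  | zero => simp [BOne_zero]
  | succ n ih =>
    rw [BOne_succ]
    exact mul_ne_zero (qInt_succ_ne_zero (2 * n + 1)) ih

theorem invSum_increasing (n : ℕ) : invSum n (fun f => ∀ i < n, f i < f (i + 1)) = 1 := by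
  have key : ∀ w : BG n, (∀ i < n, bval w i < bval w (i + 1)) → w = (1, fun _ => false) := by
    intro w h
    have hpos : ∀ i < n, 0 < bval w (i + 1) := by
      intro i hi
      induction i with
      | zero => simpa [bval_zero] using h 0 hi
      | succ i ih => exact (ih (by omega)).trans (h (i + 1) hi)
    have hsign : ∀ i, w.2 i = false := fun i => by
      have := hpos i i.2
      rw [bval_succ] at this
      by_contra hc
      simp only [Bool.not_eq_false] at hc
      rw [if_pos hc] at this
      omega
    have hval : ∀ i : Fin n, bval w (i + 1) = (w.1 i : ℕ) + 1 := fun i => by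
      rw [bval_succ, hsign]
      simp
    have hmono : StrictMono w.1 := by
      obtain _ | n := n
      · exact fun i => i.elim0
      refine Fin.strictMono_iff_lt_succ.2 fun i => ?_
      have h1 := hval i.castSucc
      have h2 := hval i.succ
      have h3 := h (i + 1) (by omega)
      simp only [Fin.val_castSucc, Fin.val_succ] at h1 h2
      rw [h1, h2] at h3
      rw [Fin.lt_def]
      omega
    refine Prod.ext (Equiv.ext fun i => ?_) (funext hsign)
    exact DFunLike.congr_fun (Subsingleton.elim (hmono.orderIsoOfSurjective _ w.1.surjective)
      (OrderIso.refl _)) i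
  have hv : ∀ i ≤ n, bval ((1, fun _ => false) : BG n) i = i := by
    intro i hi
    obtain _ | i := i
    · simp [bval_zero]
    · simpa using bval_succ ((1, fun _ => false) : BG n) ⟨i, hi⟩
  unfold invSum
  refine (Fintype.sum_eq_single ((1, fun _ => false) : BG n)
    fun w hw => if_neg fun h => hw (key w h)).trans ?_
  rw [if_pos fun i hi => ?_]
  · have : wordInv (bval ((1, fun _ => false) : BG n)) n = 0 := by
      refine sum_eq_zero fun j hj => ?_
      simp only [mem_range] at hj
      rw [hv (j + 1) hj, if_neg (by omega), add_zero]
      refine sum_eq_zero fun i hi => ?_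
      simp only [mem_range] at hi
      rw [hv (i + 1) (by omega), if_neg (by omega), if_neg (by omega), add_zero]
    rw [this, pow_zero]
  · rw [hv i hi.le, hv (i + 1) hi]
    omega

/-- The snake conditions at the positions `0, …, k`. -/
def SnakeUpTo (k : ℕ) (f : ℕ → ℤ) : Prop :=
  ∀ i < k, (Even i → f i < f (i + 1)) ∧ (Odd i → f (i + 1) < f i)

theorem snakeUpTo_succ {k : ℕ} {f : ℕ → ℤ} : SnakeUpTo (k + 1) f ↔
    SnakeUpTo k f ∧ (Even k → f k < f (k + 1)) ∧ (Odd k → f (k + 1) < f k) :=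
  Nat.forall_lt_succ_right

theorem isPattern_snakeUpTo (k : ℕ) : IsPattern k (SnakeUpTo k) := by
  intro f g h
  unfold SnakeUpTo
  refine forall_congr' fun i => forall_congr' fun hi => ?_
  rw [h i (i + 1) (by omega) (by omega), h (i + 1) i (by omega) (by omega)]

theorem SB_eq_invSum (n : ℕ) : SB n = invSum n (SnakeUpTo n) := by
  classical
  rw [SB, SnakeB, sum_filter]
  refine sum_congr rfl fun w _ => ?_
  rw [invB_eq_wordInv]
  exact if_congr Iff.rfl rfl rfl

/-- The generating function of the words of length `n` satisfying the snake conditions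
up to position `j`, and increasing along the positions `k + 1, …, n`. -/
def snakeIncSum (n j k : ℕ) : Kq :=
  invSum n fun f => SnakeUpTo j f ∧ ∀ i, k < i → i < n → f i < f (i + 1)

theorem snakeIncSum_self (n k : ℕ) (h : n ≤ k + 1) : snakeIncSum n n k = SB n := by
  rw [SB_eq_invSum]
  refine invSum_congr fun w => and_iff_left fun i _ _ => ?_
  omega

theorem snakeIncSum_mul (n k : ℕ) (h : k ≤ n) :
    snakeIncSum n k k * (qFact (n - k) qv * BOne k qv) = SB k * BOne n qv := by
  obtain ⟨m, rfl⟩ := Nat.exists_eq_add_of_le h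
  rw [Nat.add_sub_cancel_left, SB_eq_invSum, ← invSum_incFrom_mul (isPattern_snakeUpTo k) m]
  rfl

theorem snakeIncSum_split {n s : ℕ} (h : 2 * s + 2 ≤ n) :
    snakeIncSum n (2 * s + 1) (2 * s + 1)
      = snakeIncSum n (2 * s + 2) (2 * s + 1) + snakeIncSum n (2 * s + 1) (2 * s) := by
  have ho : Odd (2 * s + 1) := ⟨s, rfl⟩
  have he : ¬ Even (2 * s + 1) := Nat.not_even_iff_odd.2 ho
  rw [snakeIncSum, invSum_eq_add_of_lt h, add_comm]
  congr 1
  · refine invSum_congr fun w => ?_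
    rw [snakeUpTo_succ (k := 2 * s + 1)]
    simp only [ho, he, forall_const, IsEmpty.forall_iff, true_and]
    tauto
  · refine invSum_congr fun w => ?_
    rw [and_assoc]
    refine and_congr_right fun _ => ⟨fun H i h1 h2 => ?_, fun H =>
      ⟨fun i h1 h2 => H i (by omega) h2, H _ (by omega) (by omega)⟩⟩
    rcases eq_or_ne i (2 * s + 1) with rfl | hne
    · exact H.2
    · exact H.1 i (by omega) h2

theorem snakeIncSum_shift {n s : ℕ} (h : 2 * s + 3 ≤ n) :
    snakeIncSum n (2 * s + 3) (2 * s + 2) = snakeIncSum n (2 * s + 2) (2 * s + 1) := by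
  have he : Even (2 * s + 2) := ⟨s + 1, by ring⟩
  have ho : ¬ Odd (2 * s + 2) := Nat.not_odd_iff_even.2 he
  refine invSum_congr fun w => ?_
  rw [snakeUpTo_succ (k := 2 * s + 2), and_assoc]
  refine and_congr_right fun _ => ?_
  simp only [ho, he, forall_const, IsEmpty.forall_iff, and_true]
  refine ⟨fun H i h1 h2 => ?_, fun H =>
    ⟨H _ (by omega) (by omega), fun i h1 h2 => H i (by omega) h2⟩⟩
  rcases eq_or_ne i (2 * s + 2) with rfl | hne
  · exact H.1
  · exact H.2 i (by omega) h2

theorem snakeIncSum_one_zero {n : ℕ} (h : 1 ≤ n) : snakeIncSum n 1 0 = 1 := by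
  rw [← invSum_increasing n]
  refine invSum_congr fun w => ⟨fun H i hi => ?_, fun H => ⟨fun i hi => ?_, fun i _ => H i⟩⟩
  · rcases Nat.eq_zero_or_pos i with rfl | hi'
    · exact (H.1 0 one_pos).1 Even.zero
    · exact H.2 i hi' hi
  · obtain rfl : i = 0 := by omega
    exact ⟨fun _ => H 0 h, fun h0 => absurd h0 (by decide)⟩

theorem sum_snakeIncSum {n : ℕ} (s : ℕ) (h : 2 * s + 2 ≤ n) :
    ∑ i ∈ range (s + 1), (-1) ^ i * snakeIncSum n (2 * i + 1) (2 * i + 1)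
      = (-1) ^ s * snakeIncSum n (2 * s + 2) (2 * s + 1) + 1 := by
  induction s with
  | zero =>
    simp only [zero_add, range_one, sum_singleton]
    rw [snakeIncSum_split h]
    simp [snakeIncSum_one_zero (show 1 ≤ n by omega)]
  | succ s ih =>
    rw [sum_range_succ, ih (by omega), snakeIncSum_split h]
    have := snakeIncSum_shift (n := n) (s := s) (by omega)
    rw [show 2 * (s + 1) + 1 = 2 * s + 3 by ring, show 2 * (s + 1) = 2 * s + 2 by ring, this]
    ring

theorem sum_snakeIncSum_odd (N : ℕ) :
    ∑ i ∈ range (N + 1), (-1) ^ i * snakeIncSum (2 * N + 1) (2 * i + 1) (2 * i + 1) = 1 := by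
  obtain _ | N := N
  · have h := snakeIncSum_self 1 0 le_rfl
    rw [snakeIncSum_one_zero le_rfl, ← snakeIncSum_self 1 1 (by omega)] at h
    simp [← h]
  · rw [sum_range_succ, sum_snakeIncSum N (by omega), ← snakeIncSum_shift (by omega),
      show 2 * (N + 1) + 1 = 2 * N + 3 by ring, snakeIncSum_self _ (2 * N + 2) (by omega),
      snakeIncSum_self _ (2 * N + 3) (by omega)]
    ring

theorem sum_snakeIncSum_even (N : ℕ) :
    ∑ i ∈ range (N + 1), (-1) ^ i * snakeIncSum (2 * N + 2) (2 * i + 1) (2 * i + 1)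
      = (-1) ^ N * SB (2 * N + 2) + 1 := by
  rw [sum_snakeIncSum N le_rfl, snakeIncSum_self _ _ (by omega)]

theorem sum_range_two_mul {M : Type*} [AddCommMonoid M] (g : ℕ → M) (n : ℕ) :
    ∑ k ∈ range (2 * n), g k = ∑ i ∈ range n, (g (2 * i) + g (2 * i + 1)) := by
  induction n with
  | zero => simp
  | succ n ih => rw [Nat.mul_succ, sum_range_succ, sum_range_succ, ih, sum_range_succ, add_assoc]

/-- The part of `∑ S_n^B(q) u^n / B_n(1,q)` of odd degree. -/
def oddSnakeSeries : PowerSeries Kq :=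
  PowerSeries.mk fun n => if Odd n then SB n / BOne n qv else 0

/-- The part of `∑ S_n^B(q) u^n / B_n(1,q)` of even degree. -/
def evenSnakeSeries : PowerSeries Kq :=
  PowerSeries.mk fun n => if Even n then SB n / BOne n qv else 0

theorem snakeSeries_eq_add :
    (PowerSeries.mk fun n => SB n / BOne n qv) = evenSnakeSeries + oddSnakeSeries := by
  ext n
  rcases Nat.even_or_odd n with h | h
  · simp [evenSnakeSeries, oddSnakeSeries, h, Nat.not_odd_iff_even.2 h]
  · simp [evenSnakeSeries, oddSnakeSeries, h, Nat.not_even_iff_odd.2 h]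

theorem SB_div_mul_inv_qFact {n k : ℕ} (h : k ≤ n) :
    SB k / BOne k qv * (qFact (n - k) qv)⁻¹ = snakeIncSum n k k / BOne n qv := by
  have h1 := BOne_ne_zero k
  have h2 := BOne_ne_zero n
  have h3 := qFact_ne_zero (n - k)
  have h4 := snakeIncSum_mul n k h
  field_simp
  linear_combination -h4

theorem oddSnakeSeries_mul_cosq : oddSnakeSeries * cosq = sinB := by
  ext n
  rw [PowerSeries.coeff_mul, Finset.Nat.sum_antidiagonal_eq_sum_range_succ_mk]
  simp only [oddSnakeSeries, cosq, sinB, PowerSeries.coeff_mk]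
  rcases Nat.even_or_odd' n with ⟨N, rfl | rfl⟩
  · rw [if_neg (by simp)]
    refine sum_eq_zero fun k hk => ?_
    simp only [mem_range] at hk
    by_cases h : Odd k
    · rw [if_neg (c := Even _), mul_zero]
      rw [Nat.even_sub (by omega)]
      simp [h]
    · rw [if_neg h, zero_mul]
  · rw [if_pos (by simp), show (2 * N + 1).succ = 2 * (N + 1) by omega, sum_range_two_mul,
      show (2 * N + 1) / 2 = N by omega]
    have key : ∀ i ∈ range (N + 1), ((if Odd (2 * i) then SB (2 * i) / BOne (2 * i) qv else 0) *
          (if Even (2 * N + 1 - 2 * i) then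
            (-1 : Kq) ^ ((2 * N + 1 - 2 * i) / 2) * (qFact (2 * N + 1 - 2 * i) qv)⁻¹ else 0) +
        (if Odd (2 * i + 1) then SB (2 * i + 1) / BOne (2 * i + 1) qv else 0) *
          (if Even (2 * N + 1 - (2 * i + 1)) then (-1 : Kq) ^ ((2 * N + 1 - (2 * i + 1)) / 2) *
            (qFact (2 * N + 1 - (2 * i + 1)) qv)⁻¹ else 0))
        = (-1) ^ N * (BOne (2 * N + 1) qv)⁻¹ *
          ((-1) ^ i * snakeIncSum (2 * N + 1) (2 * i + 1) (2 * i + 1)) := by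
      intro i hi
      simp only [mem_range] at hi
      obtain ⟨j, rfl⟩ := Nat.exists_eq_add_of_le (Nat.lt_succ_iff.1 hi)
      have e : 2 * (i + j) + 1 - (2 * i + 1) = 2 * j := by omega
      have hq := SB_div_mul_inv_qFact (show 2 * i + 1 ≤ 2 * (i + j) + 1 by omega)
      rw [e] at hq ⊢
      rw [if_neg (by simp), if_pos (c := Odd (2 * i + 1)) (by simp),
        if_pos (c := Even (2 * j)) (by simp),
        show 2 * j / 2 = j by omega, pow_add, zero_mul, zero_add]
      have h1 : (-1 : Kq) ^ i * (-1) ^ i = 1 := by rw [← mul_pow]; simp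
      linear_combination (-1 : Kq) ^ j * hq - snakeIncSum (2 * (i + j) + 1) (2 * i + 1) (2 * i + 1)
        / BOne (2 * (i + j) + 1) qv * (-1) ^ j * h1
    rw [sum_congr rfl key, ← mul_sum, sum_snakeIncSum_odd, mul_one]

theorem oddSnakeSeries_mul_sinq : oddSnakeSeries * sinq = evenSnakeSeries - cosB := by
  ext n
  rw [PowerSeries.coeff_mul, Finset.Nat.sum_antidiagonal_eq_sum_range_succ_mk, map_sub]
  simp only [oddSnakeSeries, evenSnakeSeries, sinq, cosB, PowerSeries.coeff_mk]
  rcases Nat.even_or_odd' n with ⟨N, rfl | rfl⟩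
  · obtain _ | N := N
    · have h0 : SB 0 = 1 := by
        rw [SB_eq_invSum, ← invSum_increasing 0]
        exact invSum_congr fun w => ⟨fun _ i hi => by omega, fun _ i hi => by omega⟩
      simp [h0]
    · rw [if_pos (by simp), if_pos (by simp), sum_range_succ, sum_range_two_mul,
        show 2 * (N + 1) / 2 = N + 1 by omega, if_neg (c := Odd (2 * (N + 1))) (by simp),
        zero_mul, add_zero]
      have key : ∀ i ∈ range (N + 1), ((if Odd (2 * i) then SB (2 * i) / BOne (2 * i) qv else 0) *
            (if Odd (2 * (N + 1) - 2 * i) then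
              (-1 : Kq) ^ ((2 * (N + 1) - 2 * i) / 2) * (qFact (2 * (N + 1) - 2 * i) qv)⁻¹ else 0) +
          (if Odd (2 * i + 1) then SB (2 * i + 1) / BOne (2 * i + 1) qv else 0) *
            (if Odd (2 * (N + 1) - (2 * i + 1)) then
              (-1 : Kq) ^ ((2 * (N + 1) - (2 * i + 1)) / 2) *
              (qFact (2 * (N + 1) - (2 * i + 1)) qv)⁻¹ else 0))
          = (-1) ^ N * (BOne (2 * N + 2) qv)⁻¹ *
            ((-1) ^ i * snakeIncSum (2 * N + 2) (2 * i + 1) (2 * i + 1)) := by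
        intro i hi
        simp only [mem_range] at hi
        obtain ⟨j, rfl⟩ := Nat.exists_eq_add_of_le (Nat.lt_succ_iff.1 hi)
        have e : 2 * (i + j) + 2 - (2 * i + 1) = 2 * j + 1 := by omega
        have hq := SB_div_mul_inv_qFact (show 2 * i + 1 ≤ 2 * (i + j) + 2 by omega)
        rw [show 2 * (i + j + 1) = 2 * (i + j) + 2 by ring]
        rw [e] at hq ⊢
        rw [if_neg (c := Odd (2 * i)) (by simp), if_pos (c := Odd (2 * i + 1)) (by simp),
          if_pos (c := Odd (2 * j + 1)) (by simp),
          show (2 * j + 1) / 2 = j by omega, pow_add, zero_mul, zero_add]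
        have h1 : (-1 : Kq) ^ i * (-1) ^ i = 1 := by rw [← mul_pow]; simp
        linear_combination (-1 : Kq) ^ j * hq -
          snakeIncSum (2 * (i + j) + 2) (2 * i + 1) (2 * i + 1)
          / BOne (2 * (i + j) + 2) qv * (-1) ^ j * h1
      rw [sum_congr rfl key, ← mul_sum, sum_snakeIncSum_even, show 2 * (N + 1) = 2 * N + 2 by ring]
      have h1 : (-1 : Kq) ^ N * (-1) ^ N = 1 := by rw [← mul_pow]; simp
      linear_combination SB (2 * N + 2) / BOne (2 * N + 2) qv * h1
  · rw [if_neg (by simp), if_neg (by simp), sub_zero]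
    refine sum_eq_zero fun k hk => ?_
    simp only [mem_range] at hk
    by_cases h : Odd k
    · rw [if_neg (c := Odd (2 * N + 1 - k)), mul_zero]
      rw [Nat.odd_sub (by omega)]
      simp [h]
    · rw [if_neg h, zero_mul]

theorem q_snakes_typeB :
    (PowerSeries.mk fun n => SB n / BOne n qv) * cosq
      = cosq * cosB + (1 + sinq) * sinB := by
  rw [snakeSeries_eq_add]
  linear_combination (1 + sinq) * oddSnakeSeries_mul_cosq - cosq * oddSnakeSeries_mul_sinq

end
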